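/- arXiv:1611.06258 — 3 statements merged into one kernel-verified Lean document; each statement's English description precedes it below -/
import Mathlib

section
/- Let K, ω₀ > 0, W > 1 and F < 0, and let H := H_{K,ω₀,W,F}. Set ν := −Fω₀/W and β := (F² + W²)(1 − W)ω₀ / (2WF). Then ν > 0, β > 0, H(ν) = KW, and, as an identity in ℝ(s), (ν·H(s) − s·KW) / (ν·KW − s·H(s)) = W + 2βs/(s² + ω₀²). -/
open Polynomial Matrix

/-- Evaluation of a real rational function at a complex point:
`p(λ)/q(λ)` for `H = p/q` in coprime (num/denom) form. -/
noncomputable def evalC (H : RatFunc ℝ) (z : ℂ) : ℂ :=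
  H.num.eval₂ (algebraMap ℝ ℂ) z / H.denom.eval₂ (algebraMap ℝ ℂ) z

/-- Evaluation of a real rational function at a real point. -/
noncomputable def evalR (H : RatFunc ℝ) (x : ℝ) : ℝ :=
  H.num.eval x / H.denom.eval x

/-- `H` is positive-real: the denominator has no root with strictly positive real
part, and `Re (H λ) ≥ 0` whenever `Re λ > 0`. -/
def IsPR (H : RatFunc ℝ) : Prop :=
  (∀ z : ℂ, 0 < z.re → H.denom.eval₂ (algebraMap ℝ ℂ) z ≠ 0) ∧
  (∀ z : ℂ, 0 < z.re → 0 ≤ (evalC H z).re)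

/-- `H` has no poles or zeros on `jℝ ∪ ∞`: numerator and denominator have equal
degree and neither has a purely imaginary root. -/
def NoImagPolesZeros (H : RatFunc ℝ) : Prop :=
  H.num.natDegree = H.denom.natDegree ∧
  (∀ ω : ℝ, H.num.eval₂ (algebraMap ℝ ℂ) ((ω : ℂ) * Complex.I) ≠ 0) ∧
  (∀ ω : ℝ, H.denom.eval₂ (algebraMap ℝ ℂ) ((ω : ℂ) * Complex.I) ≠ 0)

/-- `H` is a minimum function with minimum frequency `ω₀`. -/
def IsMinFun (H : RatFunc ℝ) (ω₀ : ℝ) : Prop :=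
  IsPR H ∧ H ≠ 0 ∧ NoImagPolesZeros H ∧ 0 < ω₀ ∧
    (evalC H ((ω₀ : ℂ) * Complex.I)).re = 0

/-- The McMillan degree of a rational function. -/
noncomputable def McMillanDeg (H : RatFunc ℝ) : ℕ :=
  max H.num.natDegree H.denom.natDegree

/-- The biquadratic parametrisation of Lemma `bmfp`. -/
noncomputable def Hparam (K ω₀ W F : ℝ) : RatFunc ℝ :=
  RatFunc.C K *
    (RatFunc.X ^ 2 + RatFunc.C (ω₀ * (1 - W) * F / W) * RatFunc.X +
        RatFunc.C (ω₀ ^ 2 * W)) /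
    (RatFunc.X ^ 2 + RatFunc.C (ω₀ * (1 - W) / F) * RatFunc.X +
        RatFunc.C (ω₀ ^ 2 / W))

/-- Composition of a rational function with the map `s ↦ ω₀²/s`. -/
noncomputable def freqInv (ω₀ : ℝ) (H : RatFunc ℝ) : RatFunc ℝ :=
  RatFunc.eval (algebraMap ℝ (RatFunc ℝ)) (RatFunc.C (ω₀ ^ 2) / RatFunc.X) H

theorem evalR_div_algebraMap (p q : ℝ[X]) (x : ℝ) (hq : q.eval x ≠ 0) :
    evalR (algebraMap ℝ[X] (RatFunc ℝ) p / algebraMap ℝ[X] (RatFunc ℝ) q) x =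
      p.eval x / q.eval x := by
  have hq0 : q ≠ 0 := by
    rintro rfl
    simp at hq
  have hd := RatFunc.denom_div_dvd p q
  have hdx : (algebraMap ℝ[X] (RatFunc ℝ) p / algebraMap ℝ[X] (RatFunc ℝ) q).denom.eval x ≠ 0 :=
    fun h => hq (Polynomial.eval_eq_zero_of_dvd_of_eval_eq_zero hd h)
  have h := congrArg (Polynomial.eval x)
    ((RatFunc.num_mul_eq_mul_denom_iff (p := p) hq0).2 rfl)
  simp only [Polynomial.eval_mul] at h
  rw [evalR, div_eq_div_iff hdx hq, h]

theorem ratFunc_quadratic_ne_zero (b c : ℝ) :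
    (RatFunc.X ^ 2 + RatFunc.C b * RatFunc.X + RatFunc.C c : RatFunc ℝ) ≠ 0 := by
  have h : (Polynomial.C 1 * X ^ 2 + Polynomial.C b * X + Polynomial.C c : ℝ[X]) ≠ 0 := by
    intro h
    have hdeg := Polynomial.natDegree_quadratic (b := b) (c := c) (one_ne_zero (α := ℝ))
    rw [h, Polynomial.natDegree_zero] at hdeg
    exact two_ne_zero hdeg.symm
  simpa using (map_ne_zero_iff _ (RatFunc.algebraMap_injective ℝ)).2 h

theorem ratFunc_C_sub_X_ne_zero (a : ℝ) : (RatFunc.C a - RatFunc.X : RatFunc ℝ) ≠ 0 := by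
  have h := (map_ne_zero_iff _ (RatFunc.algebraMap_injective ℝ)).2 (Polynomial.X_sub_C_ne_zero a)
  rw [map_sub, RatFunc.algebraMap_X, RatFunc.algebraMap_C] at h
  rw [← neg_sub]
  exact neg_ne_zero.2 h

theorem evalR_Hparam (K ω₀ W F x : ℝ)
    (hx : x ^ 2 + ω₀ * (1 - W) / F * x + ω₀ ^ 2 / W ≠ 0) :
    evalR (Hparam K ω₀ W F) x =
      K * (x ^ 2 + ω₀ * (1 - W) * F / W * x + ω₀ ^ 2 * W) /
        (x ^ 2 + ω₀ * (1 - W) / F * x + ω₀ ^ 2 / W) := by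
  have h := evalR_div_algebraMap
    (Polynomial.C K * (X ^ 2 + Polynomial.C (ω₀ * (1 - W) * F / W) * X + Polynomial.C (ω₀ ^ 2 * W)))
    (X ^ 2 + Polynomial.C (ω₀ * (1 - W) / F) * X + Polynomial.C (ω₀ ^ 2 / W)) x
    (by simpa only [Polynomial.eval_add, Polynomial.eval_mul, Polynomial.eval_pow,
      Polynomial.eval_X, Polynomial.eval_C] using hx)
  simpa only [Hparam, map_add, map_mul (algebraMap ℝ[X] (RatFunc ℝ)),
    map_pow (algebraMap ℝ[X] (RatFunc ℝ)), RatFunc.algebraMap_X, RatFunc.algebraMap_C, Polynomial.eval_add, Polynomial.eval_mul,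
    Polynomial.eval_pow, Polynomial.eval_X, Polynomial.eval_C] using h

/-- The common factor `ν - s` of numerator and denominator of the Richards transform cancels. -/
theorem richards_biquadratic {L : Type*} [Field L] {k o w f s : L} (h2 : (2 : L) ≠ 0)
    (hk : k ≠ 0) (hw : w ≠ 0) (hf : f ≠ 0)
    (hD : s ^ 2 + o * (1 - w) / f * s + o ^ 2 / w ≠ 0)
    (hs : s ^ 2 + o ^ 2 ≠ 0) (hν : -f * o / w - s ≠ 0) :
    (-f * o / w * (k * (s ^ 2 + o * (1 - w) * f / w * s + o ^ 2 * w) /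
          (s ^ 2 + o * (1 - w) / f * s + o ^ 2 / w)) - s * (k * w)) /
        (-f * o / w * (k * w) - s * (k * (s ^ 2 + o * (1 - w) * f / w * s + o ^ 2 * w) /
          (s ^ 2 + o * (1 - w) / f * s + o ^ 2 / w))) =
      w + 2 * ((f ^ 2 + w ^ 2) * (1 - w) * o / (2 * w * f)) * s / (s ^ 2 + o ^ 2) := by
  set D := s ^ 2 + o * (1 - w) / f * s + o ^ 2 / w with hD_def
  have hden : -f * o / w * (k * w) - s * (k * (s ^ 2 + o * (1 - w) * f / w * s + o ^ 2 * w) / D) =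
      k * (-f * o / w - s) * (s ^ 2 + o ^ 2) / D := by
    rw [eq_div_iff hD, sub_mul, mul_assoc s, div_mul_cancel₀ _ hD, hD_def]
    field_simp
    ring
  have hnum : -f * o / w * (k * (s ^ 2 + o * (1 - w) * f / w * s + o ^ 2 * w) / D) - s * (k * w) =
      k * (-f * o / w - s) *
        (w * (s ^ 2 + o ^ 2) + 2 * ((f ^ 2 + w ^ 2) * (1 - w) * o / (2 * w * f)) * s) / D := by
    rw [eq_div_iff hD, sub_mul, mul_assoc (-f * o / w), div_mul_cancel₀ _ hD, hD_def]
    field_simp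
    ring
  rw [hden, hnum, div_div_div_cancel_right₀ hD, mul_div_mul_left _ _ (mul_ne_zero hk hν), add_div,
    mul_div_cancel_right₀ _ hs]

/-- for `W > 1`, `F < 0`, the biquadratic minimum function
`H := Hparam K ω₀ W F` satisfies, with `ν := −Fω₀/W` and
`β := (F² + W²)(1−W)ω₀/(2WF)`: `ν, β > 0`, `H(ν) = KW`, and
`(νH − sKW)/(νKW − sH) = W + 2βs/(s² + ω₀²)`. -/
theorem stmt14 (K ω₀ W F : ℝ) (hK : 0 < K) (hω : 0 < ω₀)
    (hW : 1 < W) (hF : F < 0) :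
    0 < -F * ω₀ / W ∧
    0 < (F ^ 2 + W ^ 2) * (1 - W) * ω₀ / (2 * W * F) ∧
    evalR (Hparam K ω₀ W F) (-F * ω₀ / W) = K * W ∧
    (RatFunc.C (-F * ω₀ / W) * Hparam K ω₀ W F -
          RatFunc.X * RatFunc.C (K * W)) /
        (RatFunc.C (-F * ω₀ / W * (K * W)) - RatFunc.X * Hparam K ω₀ W F) =
      RatFunc.C W +
        RatFunc.C (2 * ((F ^ 2 + W ^ 2) * (1 - W) * ω₀ / (2 * W * F))) *
          RatFunc.X / (RatFunc.X ^ 2 + RatFunc.C (ω₀ ^ 2)) := by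
  have hW0 : 0 < W := by linarith
  refine ⟨div_pos (mul_pos (neg_pos.2 hF) hω) hW0, ?_, ?_, ?_⟩
  · refine div_pos_of_neg_of_neg ?_ (mul_neg_of_pos_of_neg (by positivity) hF)
    exact mul_neg_of_neg_of_pos (mul_neg_of_pos_of_neg (by positivity) (by linarith)) hω
  · have hD : (-F * ω₀ / W) ^ 2 + ω₀ * (1 - W) / F * (-F * ω₀ / W) + ω₀ ^ 2 / W =
        ω₀ ^ 2 * (F ^ 2 + W ^ 2) / W ^ 2 := by
      have := hF.ne
      field_simp
      ring
    have hD0 : ω₀ ^ 2 * (F ^ 2 + W ^ 2) / W ^ 2 ≠ 0 := by positivity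
    rw [evalR_Hparam _ _ _ _ _ (hD ▸ hD0), hD, div_eq_iff hD0]
    field_simp
    ring
  · have hD := ratFunc_quadratic_ne_zero (ω₀ * (1 - W) / F) (ω₀ ^ 2 / W)
    have hs := ratFunc_quadratic_ne_zero 0 (ω₀ ^ 2)
    have hν := ratFunc_C_sub_X_ne_zero (-F * ω₀ / W)
    have hC {a : ℝ} (ha : a ≠ 0) : RatFunc.C a ≠ 0 := (_root_.map_ne_zero RatFunc.C).2 ha
    simp only [map_zero, zero_mul, add_zero] at hs
    simp only [map_mul, map_div₀, map_sub, map_neg, map_pow, map_one] at hD hs hν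
    simp only [Hparam, map_mul, map_div₀, map_add, map_sub, map_neg, map_pow, map_one, map_ofNat]
    exact richards_biquadratic two_ne_zero (hC hK.ne') (hC hW0.ne') (hC hF.ne) hD hs hν
end

section
/- Let H be a biquadratic minimum function. Then H(0) ≠ H(∞), i.e., the value of H at 0 is not equal to the ratio of the leading coefficients of its numerator and denominator. -/
open Polynomial Matrix

/-- A monic real quadratic without roots in the closed right half-plane has positive
coefficients. -/
theorem pos_of_quadratic_ne_zero {d e : ℝ}
    (h : ∀ z : ℂ, 0 ≤ z.re → z ^ 2 + d * z + e ≠ 0) : 0 < d ∧ 0 < e := by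
  have of_disc_nonneg (hD : 0 ≤ d ^ 2 - 4 * e) : d < √(d ^ 2 - 4 * e) → False := by
    intro hlt
    have hs := Real.sq_sqrt hD
    set r := √(d ^ 2 - 4 * e)
    refine h (((-d + r) / 2 : ℝ) : ℂ) (by rw [Complex.ofReal_re]; linarith) ?_
    norm_cast
    linear_combination hs / 4
  have he : 0 < e := by
    have h0 : e ≠ 0 := by
      rintro rfl
      exact h 0 le_rfl (by simp)
    by_contra hneg
    have hlt : e < 0 := lt_of_le_of_ne (not_lt.mp hneg) h0
    refine of_disc_nonneg (by nlinarith [sq_nonneg d]) (Real.lt_sqrt_of_sq_lt (by linarith))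
  refine ⟨?_, he⟩
  by_contra hd
  rw [not_lt] at hd
  rcases le_or_gt 0 (d ^ 2 - 4 * e) with hD | hD
  · have hd0 : d ≠ 0 := by
      rintro rfl
      linarith
    exact of_disc_nonneg hD ((lt_of_le_of_ne hd hd0).trans_le (Real.sqrt_nonneg _))
  · have hs := Real.sq_sqrt (show 0 ≤ 4 * e - d ^ 2 by linarith)
    set r := √(4 * e - d ^ 2)
    refine h ⟨-d / 2, r / 2⟩ (by change 0 ≤ -d / 2; linarith) ?_
    apply Complex.ext
    · simp [pow_two]
      linear_combination -hs / 4
    · simp [pow_two]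
      ring

/-- A positive-real biquadratic function whose values at zero and infinity agree, and which has
no zeros on the imaginary axis, has positive numerator coefficients. -/
theorem pos_of_biquadratic_re_nonneg {a b d e : ℝ} (ha : a ≠ 0) (hd : 0 < d) (he : 0 < e)
    (hre : ∀ z : ℂ, 0 < z.re →
      0 ≤ ((a * z ^ 2 + b * z + (a * e : ℝ)) / (z ^ 2 + d * z + e)).re)
    (hz : ∀ ω : ℝ, a * (ω * Complex.I) ^ 2 + b * (ω * Complex.I) + (a * e : ℝ) ≠ (0 : ℂ)) :
    0 < a ∧ 0 < b := by
  have hapos : 0 < a := by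
    by_contra hn
    have hlt : a < 0 := lt_of_le_of_ne (not_lt.mp hn) ha
    have hx : 0 < 1 + |b| / (-a) := by
      have : 0 ≤ |b| / (-a) := div_nonneg (abs_nonneg b) (by linarith)
      linarith
    set x := 1 + |b| / (-a) with hxd
    have hax : a * x = a - |b| := by
      rw [hxd]
      field_simp
      ring
    have h1 := hre (x : ℂ) (by simpa using hx)
    norm_cast at h1
    have hq : 0 < x ^ 2 + d * x + e := by positivity
    have hp : a * x ^ 2 + b * x + a * e < 0 := by
      nlinarith [le_abs_self b, mul_neg_of_neg_of_pos hlt he, mul_neg_of_neg_of_pos hlt hx,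
        mul_nonneg (sub_nonneg.mpr (le_abs_self b)) hx.le]
    exact absurd h1 (not_le.mpr (div_neg_of_neg_of_pos hp hq))
  refine ⟨hapos, ?_⟩
  by_contra hn
  have hb : b ≠ 0 := by
    rintro rfl
    apply hz √e
    have hs : ((√e : ℝ) : ℂ) ^ 2 = e := by exact_mod_cast Real.sq_sqrt he.le
    rw [mul_pow, hs, Complex.I_sq]
    push_cast
    ring
  have hlt : b < 0 := lt_of_le_of_ne (not_lt.mp hn) hb
  obtain ⟨x, hx0, hx⟩ := exists_between
    (lt_min (Real.sqrt_pos.mpr he) (show 0 < -b / (2 * a) from div_pos (by linarith) (by linarith)))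
  have hxe : x ^ 2 < e := (Real.lt_sqrt hx0.le).mp (hx.trans_le (min_le_left _ _))
  have hxb : x * (2 * a) < -b :=
    (lt_div_iff₀ (by linarith)).mp (hx.trans_le (min_le_right _ _))
  have hs := Real.sq_sqrt (show 0 ≤ e - x ^ 2 by linarith)
  set y := √(e - x ^ 2)
  have h1 := hre ⟨x, y⟩ hx0
  have hzz : (⟨x, y⟩ : ℂ) ^ 2 = 2 * x * ⟨x, y⟩ - e := by
    apply Complex.ext
    · simp [pow_two]
      linear_combination -hs
    · simp [pow_two]
      ring
  have hz0 : (⟨x, y⟩ : ℂ) ≠ 0 := fun h0 => hx0.ne' (congrArg Complex.re h0)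
  have hnum : (a * ⟨x, y⟩ ^ 2 + b * ⟨x, y⟩ + (a * e : ℝ) : ℂ)
      = ((x * (2 * a) + b : ℝ) : ℂ) * ⟨x, y⟩ := by
    rw [hzz]
    push_cast
    ring
  have hden : (⟨x, y⟩ ^ 2 + d * ⟨x, y⟩ + e : ℂ) = ((2 * x + d : ℝ) : ℂ) * ⟨x, y⟩ := by
    rw [hzz]
    push_cast
    ring
  rw [hnum, hden, mul_div_mul_right _ _ hz0] at h1
  norm_cast at h1
  exact absurd h1 (not_le.mpr (div_neg_of_neg_of_pos (by linarith) (by linarith)))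

/-- The real part of a biquadratic function with positive coefficients and equal values at zero
and infinity is positive on the punctured imaginary axis. -/
theorem re_biquadratic_pos {a b d e ω : ℝ} (ha : 0 < a) (hb : 0 < b) (hd : 0 < d) (hω : 0 < ω) :
    0 < ((a * (ω * Complex.I) ^ 2 + b * (ω * Complex.I) + (a * e : ℝ)) /
      ((ω * Complex.I) ^ 2 + d * (ω * Complex.I) + e) : ℂ).re := by
  have hn : (a * (ω * Complex.I) ^ 2 + b * (ω * Complex.I) + (a * e : ℝ) : ℂ)
      = ⟨a * (e - ω ^ 2), b * ω⟩ := by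
    apply Complex.ext <;> simp [pow_two]
    ring
  have hq : ((ω * Complex.I) ^ 2 + d * (ω * Complex.I) + e : ℂ) = ⟨e - ω ^ 2, d * ω⟩ := by
    apply Complex.ext <;> simp [pow_two]
    ring
  have hN : 0 < Complex.normSq ⟨e - ω ^ 2, d * ω⟩ := by
    rw [Complex.normSq_mk]
    have : 0 < d * ω * (d * ω) := by positivity
    nlinarith [mul_self_nonneg (e - ω ^ 2)]
  rw [hn, hq, Complex.div_re, ← add_div]
  refine div_pos ?_ hN
  have h1 : 0 < b * ω * (d * ω) := by positivity
  have h2 : 0 ≤ a * (e - ω ^ 2) * (e - ω ^ 2) := by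
    rw [mul_assoc]
    exact mul_nonneg ha.le (mul_self_nonneg _)
  exact add_pos_of_nonneg_of_pos h2 h1

/-- a biquadratic minimum function satisfies `H(0) ≠ H(∞)`. -/
theorem stmt15 (H : RatFunc ℝ) (hmin : ∃ ω : ℝ, IsMinFun H ω)
    (hdeg : McMillanDeg H = 2) :
    evalR H 0 ≠ H.num.leadingCoeff / H.denom.leadingCoeff := by
  intro heq
  obtain ⟨ω₀, ⟨hpole, hre⟩, -, ⟨hdegeq, hzero, himag⟩, hω, hmin0⟩ := hmin
  rw [McMillanDeg, hdegeq, max_self] at hdeg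
  rw [hdeg] at hdegeq
  have hlcp : H.num.leadingCoeff = H.num.coeff 2 := by rw [leadingCoeff, hdegeq]
  have hlcq : H.denom.coeff 2 = 1 := by
    rw [← hdeg]
    exact H.monic_denom
  have hp := eq_quadratic_of_degree_le_two (natDegree_le_iff_degree_le.mp hdegeq.le)
  have hq := eq_quadratic_of_degree_le_two (natDegree_le_iff_degree_le.mp hdeg.le)
  have ha : H.num.coeff 2 ≠ 0 := by
    rw [← hlcp, leadingCoeff_ne_zero]
    rintro h0
    simp [h0] at hdegeq
  rw [evalR, H.monic_denom.leadingCoeff, div_one, hlcp, ← coeff_zero_eq_eval_zero,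
    ← coeff_zero_eq_eval_zero] at heq
  rw [hlcq] at hq
  generalize H.num.coeff 2 = a at *
  generalize H.num.coeff 1 = b at *
  generalize H.num.coeff 0 = c at *
  generalize H.denom.coeff 1 = d at *
  generalize H.denom.coeff 0 = e at *
  have hpe (z : ℂ) : H.num.eval₂ (algebraMap ℝ ℂ) z = a * z ^ 2 + b * z + c := by
    rw [hp]
    simp
  have hqe (z : ℂ) : H.denom.eval₂ (algebraMap ℝ ℂ) z = z ^ 2 + d * z + e := by
    rw [hq]
    simp
  simp only [evalC, hpe, hqe] at hpole hre hzero himag hmin0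
  obtain ⟨hd, he⟩ : 0 < d ∧ 0 < e := by
    refine pos_of_quadratic_ne_zero fun z hz => ?_
    rcases hz.lt_or_eq with hz | hz
    · exact hpole z hz
    · have hzi : z = (z.im : ℂ) * Complex.I := by
        apply Complex.ext <;> simp [← hz]
      rw [hzi]
      exact himag z.im
  obtain rfl : c = a * e := (div_eq_iff he.ne').mp heq
  obtain ⟨ha, hb⟩ := pos_of_biquadratic_re_nonneg ha hd he hre hzero
  exact (re_biquadratic_pos ha hb hd hω).ne' hmin0
end

section
/- If H is a minimum function with minimum frequency ω₀, then the rational function G obtained from H by the substitution s ↦ ω₀²/s (i.e., G(s) = H(ω₀²/s)) is also a minimum function with minimum frequency ω₀. -/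
open Polynomial Matrix

/-- The polynomial `X ^ deg p * p (c / X)`. -/
noncomputable def inversionPoly (c : ℝ) (p : ℝ[X]) : ℝ[X] :=
  (p.comp (C c * X)).reverse

lemma natDegree_comp_C_mul_X {c : ℝ} (hc : c ≠ 0) (p : ℝ[X]) :
    (p.comp (C c * X)).natDegree = p.natDegree := by
  rw [natDegree_comp, natDegree_C_mul_X _ hc, mul_one]

lemma eval₂_inversionPoly {L : Type*} [Field L] (i : ℝ →+* L) {c : ℝ} (hc : c ≠ 0) (p : ℝ[X])
    {z : L} (hz : z ≠ 0) :
    (inversionPoly c p).eval₂ i z = z ^ p.natDegree * p.eval₂ i (i c / z) := by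
  let _ : Invertible z⁻¹ := invertibleOfNonzero (inv_ne_zero hz)
  have h := eval₂_reverse_mul_pow i z⁻¹ (p.comp (C c * X))
  rw [invOf_eq_inv, inv_inv, natDegree_comp_C_mul_X hc, eval₂_comp] at h
  simp only [eval₂_mul, eval₂_C, eval₂_X] at h
  rw [inversionPoly, div_eq_mul_inv, ← h, mul_left_comm, ← mul_pow, mul_inv_cancel₀ hz, one_pow, mul_one]

lemma natDegree_inversionPoly {c : ℝ} (hc : c ≠ 0) {p : ℝ[X]} (hp : p.coeff 0 ≠ 0) :
    (inversionPoly c p).natDegree = p.natDegree := by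
  have h : (p.comp (C c * X)).natTrailingDegree = 0 := by
    refine natTrailingDegree_eq_zero_of_constantCoeff_ne_zero ?_
    simpa [constantCoeff_apply, coeff_zero_eq_eval_zero, eval_comp] using hp
  rw [inversionPoly, reverse_natDegree, h, natDegree_comp_C_mul_X hc, Nat.sub_zero]

lemma eval₂_zero_inversionPoly_ne_zero {c : ℝ} (hc : c ≠ 0) {p : ℝ[X]} (hp : p ≠ 0) :
    (inversionPoly c p).eval₂ (algebraMap ℝ ℂ) 0 ≠ 0 := by
  have h : p.comp (C c * X) ≠ 0 := by
    rw [Ne, comp_C_mul_X_eq_zero_iff (mem_nonZeroDivisors_of_ne_zero hc)]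
    exact hp
  rw [eval₂_at_zero, inversionPoly, coeff_zero_reverse]
  simpa using h

lemma evalC_conj (H : RatFunc ℝ) (z : ℂ) :
    evalC H (starRingEnd ℂ z) = starRingEnd ℂ (evalC H z) := by
  have h (p : ℝ[X]) : p.eval₂ (algebraMap ℝ ℂ) (starRingEnd ℂ z) =
      starRingEnd ℂ (p.eval₂ (algebraMap ℝ ℂ) z) := by
    rw [hom_eval₂]
    congr 1
    ext x
    simp
  simp only [evalC, h, map_div₀]

lemma eval₂_ne_zero_of_dvd {p q : ℝ[X]} (hpq : p ∣ q) {z : ℂ}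
    (hq : q.eval₂ (algebraMap ℝ ℂ) z ≠ 0) : p.eval₂ (algebraMap ℝ ℂ) z ≠ 0 :=
  ne_zero_of_dvd_ne_zero hq (map_dvd (eval₂RingHom (algebraMap ℝ ℂ) z) hpq)

lemma evalC_div {p q : ℝ[X]} {z : ℂ} (hq : q.eval₂ (algebraMap ℝ ℂ) z ≠ 0) :
    evalC (algebraMap ℝ[X] (RatFunc ℝ) p / algebraMap ℝ[X] (RatFunc ℝ) q) z =
      p.eval₂ (algebraMap ℝ ℂ) z / q.eval₂ (algebraMap ℝ ℂ) z := by
  have hq0 : q ≠ 0 := by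
    rintro rfl
    simp at hq
  have hd := eval₂_ne_zero_of_dvd (RatFunc.denom_div_dvd p q) hq
  have h := congrArg (eval₂ (algebraMap ℝ ℂ) z)
    ((RatFunc.num_mul_eq_mul_denom_iff
      (x := algebraMap ℝ[X] (RatFunc ℝ) p / algebraMap ℝ[X] (RatFunc ℝ) q) hq0).mpr rfl)
  rw [eval₂_mul, eval₂_mul] at h
  rw [evalC, div_eq_div_iff hd hq, h]

lemma freqInv_eq_div {H : RatFunc ℝ} {ω₀ : ℝ} (hω : ω₀ ≠ 0)
    (hdeg : H.num.natDegree = H.denom.natDegree) :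
    freqInv ω₀ H = algebraMap ℝ[X] (RatFunc ℝ) (inversionPoly (ω₀ ^ 2) H.num) /
      algebraMap ℝ[X] (RatFunc ℝ) (inversionPoly (ω₀ ^ 2) H.denom) := by
  have hX : (RatFunc.X : RatFunc ℝ) ≠ 0 := RatFunc.X_ne_zero
  have h (p : ℝ[X]) : algebraMap ℝ[X] (RatFunc ℝ) p =
      p.eval₂ (algebraMap ℝ (RatFunc ℝ)) RatFunc.X :=
    (RatFunc.aeval_X_left_eq_algebraMap p).symm
  rw [h, h, eval₂_inversionPoly _ (pow_ne_zero 2 hω) _ hX,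
    eval₂_inversionPoly _ (pow_ne_zero 2 hω) _ hX, hdeg,
    mul_div_mul_left _ _ (pow_ne_zero _ hX), RatFunc.algebraMap_eq_C]
  rfl

/-- the frequency-inverted function `s ↦ H(ω₀²/s)` of a minimum
function with minimum frequency `ω₀` is again a minimum function with minimum
frequency `ω₀`. -/
theorem stmt19 (H : RatFunc ℝ) (ω₀ : ℝ) (hmin : IsMinFun H ω₀) :
    IsMinFun (freqInv ω₀ H) ω₀ := by
  obtain ⟨⟨hpole, hre⟩, -, ⟨hdeg, hnum, hden⟩, hω, hfreq⟩ := hmin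
  have hc : ω₀ ^ 2 ≠ 0 := pow_ne_zero 2 hω.ne'
  have hn0 : H.num.coeff 0 ≠ 0 := by simpa [eval₂_at_zero] using hnum 0
  have hd0 : H.denom.coeff 0 ≠ 0 := by simpa [eval₂_at_zero] using hden 0
  have hG := freqInv_eq_div hω.ne' hdeg
  set P := inversionPoly (ω₀ ^ 2) H.num with hP
  set Q := inversionPoly (ω₀ ^ 2) H.denom with hQ
  have heval (p : ℝ[X]) {z : ℂ} (hz : z ≠ 0) :
      (inversionPoly (ω₀ ^ 2) p).eval₂ (algebraMap ℝ ℂ) z =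
        z ^ p.natDegree * p.eval₂ (algebraMap ℝ ℂ) (((ω₀ ^ 2 : ℝ) : ℂ) / z) :=
    eval₂_inversionPoly _ hc p hz
  have hright {z : ℂ} (hz : 0 < z.re) : z ≠ 0 ∧ 0 < (((ω₀ ^ 2 : ℝ) : ℂ) / z).re := by
    have hz0 : z ≠ 0 := by
      rintro rfl
      simp at hz
    refine ⟨hz0, ?_⟩
    rw [div_eq_mul_inv, Complex.re_ofReal_mul, Complex.inv_re]
    have := Complex.normSq_pos.mpr hz0
    positivity
  have himag {p : ℝ[X]} (hp0 : p.coeff 0 ≠ 0)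
      (hp : ∀ ω : ℝ, p.eval₂ (algebraMap ℝ ℂ) ((ω : ℂ) * Complex.I) ≠ 0) (ω : ℝ) :
      (inversionPoly (ω₀ ^ 2) p).eval₂ (algebraMap ℝ ℂ) ((ω : ℂ) * Complex.I) ≠ 0 := by
    rcases eq_or_ne ω 0 with rfl | hne
    · have hp_ne : p ≠ 0 := by
        rintro rfl
        simp at hp0
      simpa using eval₂_zero_inversionPoly_ne_zero hc hp_ne
    · have hz : (ω : ℂ) * Complex.I ≠ 0 := by simp [hne]
      rw [heval p hz]
      refine mul_ne_zero (pow_ne_zero _ hz) ?_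
      convert hp (-(ω₀ ^ 2 / ω)) using 2
      have : (ω : ℂ) ≠ 0 := by exact_mod_cast hne
      push_cast
      field_simp
      simp
  have hQpole {z : ℂ} (hz : 0 < z.re) : Q.eval₂ (algebraMap ℝ ℂ) z ≠ 0 := by
    rw [hQ, heval _ (hright hz).1]
    exact mul_ne_zero (pow_ne_zero _ (hright hz).1) (hpole _ (hright hz).2)
  have hval {z : ℂ} (hz : z ≠ 0) (hQz : Q.eval₂ (algebraMap ℝ ℂ) z ≠ 0) :
      evalC (freqInv ω₀ H) z = evalC H (((ω₀ ^ 2 : ℝ) : ℂ) / z) := by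
    rw [hG, evalC_div hQz, hP, hQ, heval _ hz, heval _ hz, hdeg,
      mul_div_mul_left _ _ (pow_ne_zero _ hz), evalC]
  have hP0 : P ≠ 0 := by
    intro h
    have := himag hn0 hnum 0
    rw [← hP, h] at this
    simp at this
  have hQ0 : Q ≠ 0 := by
    intro h
    have := himag hd0 hden 0
    rw [← hQ, h] at this
    simp at this
  have hG0 : freqInv ω₀ H ≠ 0 := by
    rw [hG]
    exact div_ne_zero (RatFunc.algebraMap_ne_zero hP0) (RatFunc.algebraMap_ne_zero hQ0)
  have hnumdvd : (freqInv ω₀ H).num ∣ P := hG ▸ RatFunc.num_div_dvd P hQ0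
  have hdendvd : (freqInv ω₀ H).denom ∣ Q := hG ▸ RatFunc.denom_div_dvd P Q
  have hcross := (RatFunc.num_mul_eq_mul_denom_iff hQ0).mpr hG
  refine ⟨⟨fun z hz => eval₂_ne_zero_of_dvd hdendvd (hQpole hz), fun z hz => ?_⟩, hG0,
    ⟨?_, fun ω => eval₂_ne_zero_of_dvd hnumdvd (himag hn0 hnum ω),
      fun ω => eval₂_ne_zero_of_dvd hdendvd (himag hd0 hden ω)⟩, hω, ?_⟩
  · rw [hval (hright hz).1 (hQpole hz)]
    exact hre _ (hright hz).2
  · have h := congrArg natDegree hcross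
    rw [natDegree_mul (RatFunc.num_ne_zero hG0) hQ0, natDegree_mul hP0 (RatFunc.denom_ne_zero _),
      hP, hQ, natDegree_inversionPoly hc hn0, natDegree_inversionPoly hc hd0] at h
    omega
  · have hω' : (ω₀ : ℂ) ≠ 0 := by exact_mod_cast hω.ne'
    have hpt : ((ω₀ ^ 2 : ℝ) : ℂ) / ((ω₀ : ℂ) * Complex.I) =
        starRingEnd ℂ ((ω₀ : ℂ) * Complex.I) := by
      simp only [map_mul, Complex.conj_ofReal, Complex.conj_I]
      push_cast
      field_simp
      simp
    rw [hval (mul_ne_zero hω' Complex.I_ne_zero) (himag hd0 hden ω₀), hpt, evalC_conj,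
      Complex.conj_re, hfreq]
end
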